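/- Let G be a strongly connected digraph, let (x,y) be a strong bridge of G, let C be a strongly connected component of G \ (x,y), and let C' be the corresponding digraph in S(G,(x,y)). Let e be an edge of C' having an endpoint p that does not lie in C (so p ∈ {x,y}). Then e is a strong bridge of C' if and only if e is the only incoming edge of p in C' or the only outgoing edge of p in C'; and in that case the strongly connected components of C' \ e are {x} (if x ∉ C), {y} (if y ∉ C), and C. -/

import Mathlib

/-- A directed multigraph: a type `E` of potential edges with source and target
maps, together with the set of edges actually present in the digraph. -/
structure MultiDigraph (V : Type) (E : Type) where
  edges : Set E
  src : E → V
  tgt : E → V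

namespace MultiDigraph

variable {V E : Type}

/-- `G.IsWalk u v l` : the list of edges `l` forms a walk from `u` to `v`
(consecutive edges compose). -/
def IsWalk (G : MultiDigraph V E) : V → V → List E → Prop
  | u, v, [] => u = v
  | u, v, e :: l => e ∈ G.edges ∧ G.src e = u ∧ G.IsWalk (G.tgt e) v l

/-- A path from `u` to `v`: a walk using no edge more than once. -/
def IsTrail (G : MultiDigraph V E) (u v : V) (l : List E) : Prop :=
  G.IsWalk u v l ∧ l.Nodup

/-- `u` reaches `v`: there is a path from `u` to `v`. -/
def Reaches (G : MultiDigraph V E) (u v : V) : Prop :=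
  ∃ l : List E, G.IsTrail u v l

/-- `u` and `v` are strongly connected: each reaches the other. -/
def SConn (G : MultiDigraph V E) (u v : V) : Prop :=
  G.Reaches u v ∧ G.Reaches v u

/-- The digraph is strongly connected. -/
def StronglyConnected (G : MultiDigraph V E) : Prop :=
  ∀ u v : V, G.Reaches u v

/-- Delete the edge `e`. -/
def deleteEdge (G : MultiDigraph V E) (e : E) : MultiDigraph V E :=
  { G with edges := G.edges \ {e} }

/-- A strong bridge: an edge whose deletion destroys strong connectivity. -/
def IsStrongBridge (G : MultiDigraph V E) (e : E) : Prop :=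
  e ∈ G.edges ∧ ¬ (G.deleteEdge e).StronglyConnected

end MultiDigraph

namespace MultiDigraph

variable {V E : Type}

/-- `C` is a strongly connected component of `G` (as a set of vertices):
the equivalence class of some vertex under mutual reachability. -/
def IsSCC (G : MultiDigraph V E) (C : Set V) : Prop :=
  ∃ c : V, C = {w | G.SConn c w}

/-- The digraph `C'` of `S(G,(x,y))` corresponding to the strongly connected
component `C` of `G \ (x,y)`, where `(x,y)` is the strong bridge `e₀`:
it keeps every edge of `G` with both endpoints in `C`, adds one edge `(u,x)`
for every edge `(u,v)` of `G` with `u ∈ C`, `v ∉ C`, one edge `(y,v)` for every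
edge `(u,v)` of `G` with `u ∉ C`, `v ∈ C`, and the extra edge `(x,y)`
(represented by `Sum.inr ()`). -/
noncomputable def sOp (G : MultiDigraph V E) (e₀ : E) (C : Set V) :
    MultiDigraph V (E ⊕ Unit) := by
  classical
  exact
    { edges := Sum.inl '' {e | e ∈ G.edges ∧ (G.src e ∈ C ∨ G.tgt e ∈ C)} ∪
        {Sum.inr ()}
      src := fun p =>
        match p with
        | Sum.inl e => if G.src e ∈ C then G.src e else G.tgt e₀
        | Sum.inr _ => G.src e₀
      tgt := fun p =>
        match p with
        | Sum.inl e => if G.tgt e ∈ C then G.tgt e else G.src e₀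
        | Sum.inr _ => G.tgt e₀ }

/-- The digraph `G` is strongly connected when regarded as a digraph with
vertex set `W` : every vertex of `W` reaches every other vertex of `W`. -/
def SCOn (G : MultiDigraph V E) (W : Set V) : Prop :=
  ∀ a ∈ W, ∀ b ∈ W, G.Reaches a b

end MultiDigraph

namespace MultiDigraph

variable {V E : Type} {G : MultiDigraph V E}

/-- Some edge of `G` goes from `u` to `v`. -/
def HasEdge (G : MultiDigraph V E) (u v : V) : Prop :=
  ∃ e ∈ G.edges, G.src e = u ∧ G.tgt e = v

theorem IsWalk.of_append {l₁ l₂ : List E} {e : E} {u v : V}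
    (h : G.IsWalk u v (l₁ ++ e :: l₂)) : G.IsWalk (G.src e) v (e :: l₂) := by
  induction l₁ generalizing u with
  | nil => exact ⟨h.1, rfl, h.2.2⟩
  | cons a l₁ ih => exact ih h.2.2

theorem IsWalk.reflTransGen {u v : V} {l : List E} (h : G.IsWalk u v l) :
    Relation.ReflTransGen G.HasEdge u v := by
  induction l generalizing u with
  | nil => exact h ▸ .refl
  | cons e l ih => exact .head ⟨e, h.1, h.2.1, rfl⟩ (ih h.2.2)

theorem reaches_iff_reflTransGen {u v : V} :
    G.Reaches u v ↔ Relation.ReflTransGen G.HasEdge u v := by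
  refine ⟨fun ⟨_, h⟩ => h.1.reflTransGen, fun h => ?_⟩
  induction h using Relation.ReflTransGen.head_induction_on with
  | refl => exact ⟨[], rfl, List.nodup_nil⟩
  | head h _ ih =>
    obtain ⟨e, he, rfl, rfl⟩ := h
    obtain ⟨l, hl, hnd⟩ := ih
    by_cases hel : e ∈ l
    · obtain ⟨l₁, l₂, rfl⟩ := List.append_of_mem hel
      exact ⟨e :: l₂, hl.of_append, hnd.of_append_right⟩
    · exact ⟨e :: l, ⟨he, rfl, hl⟩, List.nodup_cons.2 ⟨hel, hnd⟩⟩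

theorem Reaches.refl (u : V) : G.Reaches u u := reaches_iff_reflTransGen.2 .refl

theorem Reaches.trans {u v w : V} (h₁ : G.Reaches u v) (h₂ : G.Reaches v w) : G.Reaches u w :=
  reaches_iff_reflTransGen.2
    ((reaches_iff_reflTransGen.1 h₁).trans (reaches_iff_reflTransGen.1 h₂))

theorem HasEdge.reaches {u v : V} (h : G.HasEdge u v) : G.Reaches u v :=
  reaches_iff_reflTransGen.2 (.single h)

theorem Reaches.le_of_monotone {r : V → ℕ} (hr : ∀ e ∈ G.edges, r (G.src e) ≤ r (G.tgt e))
    {u v : V} (h : G.Reaches u v) : r u ≤ r v := by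
  rw [reaches_iff_reflTransGen] at h
  induction h with
  | refl => exact le_rfl
  | tail _ h ih =>
    obtain ⟨e, he, rfl, rfl⟩ := h
    exact ih.trans (hr e he)

theorem Reaches.exists_edge_leaving {S : Set V} {u v : V} (h : G.Reaches u v) (hu : u ∈ S)
    (hv : v ∉ S) : ∃ e ∈ G.edges, G.src e ∈ S ∧ G.tgt e ∉ S := by
  rw [reaches_iff_reflTransGen] at h
  induction h with
  | refl => exact absurd hu hv
  | @tail b c _ h ih =>
    by_cases hb : b ∈ S
    · obtain ⟨e, he, rfl, rfl⟩ := h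
      exact ⟨e, he, hb, hv⟩
    · exact ih hb

/-- A walk between two vertices of a strongly connected component stays inside it. -/
theorem IsSCC.reflTransGen_inside {C : Set V} (hC : G.IsSCC C) {a b : V} (ha : a ∈ C)
    (hb : b ∈ C) :
    Relation.ReflTransGen (fun u v => u ∈ C ∧ v ∈ C ∧ G.HasEdge u v) a b := by
  obtain ⟨c, rfl⟩ := hC
  have hab := reaches_iff_reflTransGen.1 (ha.2.trans hb.1)
  induction hab using Relation.ReflTransGen.head_induction_on with
  | refl => exact .refl
  | @head u v h h' ih =>
    have hv : v ∈ {w | G.SConn c w} :=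
      ⟨ha.1.trans h.reaches, (reaches_iff_reflTransGen.2 h').trans hb.2⟩
    exact .head ⟨ha, hv, h⟩ (ih hv)

theorem IsSCC.nonempty {C : Set V} (hC : G.IsSCC C) : C.Nonempty := by
  obtain ⟨c, rfl⟩ := hC
  exact ⟨c, .refl c, .refl c⟩

theorem IsSCC.reaches {C : Set V} (hC : G.IsSCC C) {a b : V} (ha : a ∈ C) (hb : b ∈ C) :
    G.Reaches a b := by
  obtain ⟨c, rfl⟩ := hC
  exact ha.2.trans hb.1

/-- The tail of a strong bridge does not reach its head once the bridge is deleted. -/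
theorem IsStrongBridge.not_reaches {e : E} (hG : G.StronglyConnected) (he : G.IsStrongBridge e) :
    ¬ (G.deleteEdge e).Reaches (G.src e) (G.tgt e) := by
  refine fun h => he.2 fun u v => ?_
  have huv := reaches_iff_reflTransGen.1 (hG u v)
  induction huv with
  | refl => exact .refl u
  | tail _ h' ih =>
    obtain ⟨e', he', rfl, rfl⟩ := h'
    by_cases hee : e' = e
    · exact hee ▸ ih.trans (hee ▸ h)
    · exact ih.trans (HasEdge.reaches ⟨e', ⟨he', hee⟩, rfl, rfl⟩)

section sOp

variable {e₀ : E} {C : Set V}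

theorem inl_mem_sOp_edges {e : E} :
    Sum.inl e ∈ (G.sOp e₀ C).edges ↔ e ∈ G.edges ∧ (G.src e ∈ C ∨ G.tgt e ∈ C) := by
  simp [sOp, and_or_left]

theorem inr_mem_sOp_edges {i : Unit} : Sum.inr i ∈ (G.sOp e₀ C).edges := by
  simp [sOp]

theorem sOp_src_inl_of_mem {e : E} (h : G.src e ∈ C) : (G.sOp e₀ C).src (.inl e) = G.src e := by
  simp [sOp, h]

theorem sOp_src_inl_of_notMem {e : E} (h : G.src e ∉ C) :
    (G.sOp e₀ C).src (.inl e) = G.tgt e₀ := by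
  simp [sOp, h]

theorem sOp_tgt_inl_of_mem {e : E} (h : G.tgt e ∈ C) : (G.sOp e₀ C).tgt (.inl e) = G.tgt e := by
  simp [sOp, h]

theorem sOp_tgt_inl_of_notMem {e : E} (h : G.tgt e ∉ C) :
    (G.sOp e₀ C).tgt (.inl e) = G.src e₀ := by
  simp [sOp, h]

theorem sOp_src_inr {i : Unit} : (G.sOp e₀ C).src (.inr i) = G.src e₀ := rfl

theorem sOp_tgt_inr {i : Unit} : (G.sOp e₀ C).tgt (.inr i) = G.tgt e₀ := rfl

/-- Deleting an edge of `C'` with an endpoint outside `C` keeps `C` strongly connected. -/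
theorem IsSCC.reaches_sOp_deleteEdge (hC : (G.deleteEdge e₀).IsSCC C) {f : E ⊕ Unit} {p : V}
    (hp : (G.sOp e₀ C).src f = p ∨ (G.sOp e₀ C).tgt f = p) (hpC : p ∉ C) {a b : V}
    (ha : a ∈ C) (hb : b ∈ C) : ((G.sOp e₀ C).deleteEdge f).Reaches a b := by
  refine reaches_iff_reflTransGen.2 (Relation.ReflTransGen.mono ?_ _ _ (hC.reflTransGen_inside ha hb))
  rintro _ _ ⟨hu, hv, e, he, rfl, rfl⟩
  change G.src e ∈ C at hu
  change G.tgt e ∈ C at hv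
  refine ⟨.inl e, ⟨inl_mem_sOp_edges.2 ⟨he.1, .inl hu⟩, ?_⟩, sOp_src_inl_of_mem hu,
    sOp_tgt_inl_of_mem hv⟩
  rintro rfl
  rw [sOp_src_inl_of_mem hu, sOp_tgt_inl_of_mem hv] at hp
  rcases hp with rfl | rfl
  exacts [hpC hu, hpC hv]

/-- If `C` is strongly connected in `H`, then so is `C` together with a cycle through it that
visits `x` and then `y`. -/
theorem sCOn_insert_insert {H : MultiDigraph V E} {x y : V} (hne : C.Nonempty)
    (hin : ∀ a ∈ C, ∀ b ∈ C, H.Reaches a b) (hx : ∃ c ∈ C, H.Reaches c x)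
    (hxy : H.Reaches x y) (hy : ∃ c ∈ C, H.Reaches y c) : H.SCOn (insert x (insert y C)) := by
  obtain ⟨c, hc⟩ := hne
  obtain ⟨d, hd, hdx⟩ := hx
  obtain ⟨d', hd', hyd'⟩ := hy
  have hcx := (hin c hc d hd).trans hdx
  have hyc := hyd'.trans (hin d' hd' c hc)
  have key : ∀ a ∈ insert x (insert y C), H.Reaches c a ∧ H.Reaches a c := by
    rintro a (rfl | rfl | ha)
    · exact ⟨hcx, hxy.trans hyc⟩
    · exact ⟨hcx.trans hxy, hyc⟩
    · exact ⟨hin c hc a ha, hin a ha c hc⟩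
  exact fun a ha b hb => (key a ha).2.trans (key b hb).1

variable {f : E ⊕ Unit} {p : V}

/-- Unless `f` is the only edge entering or the only edge leaving `p`, deleting it keeps `C'`
strongly connected. -/
theorem sCOn_sOp_deleteEdge (hG : G.StronglyConnected) (hbr : G.IsStrongBridge e₀)
    (hC : (G.deleteEdge e₀).IsSCC C) (hf : f ∈ (G.sOp e₀ C).edges)
    (hp : (G.sOp e₀ C).src f = p ∨ (G.sOp e₀ C).tgt f = p) (hpC : p ∉ C)
    (hin : ¬ ((G.sOp e₀ C).tgt f = p ∧
      ∀ f' ∈ (G.sOp e₀ C).edges, (G.sOp e₀ C).tgt f' = p → f' = f))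
    (hout : ¬ ((G.sOp e₀ C).src f = p ∧
      ∀ f' ∈ (G.sOp e₀ C).edges, (G.sOp e₀ C).src f' = p → f' = f)) :
    ((G.sOp e₀ C).deleteEdge f).SCOn (insert (G.src e₀) (insert (G.tgt e₀) C)) := by
  have hxy : G.src e₀ ≠ G.tgt e₀ := fun h => hbr.not_reaches hG (h ▸ .refl _)
  have hsrc_ne {e : E} : (G.sOp e₀ C).src (.inl e) = G.src e₀ → G.src e₀ ∈ C := fun h => by
    by_cases he : G.src e ∈ C
    · rwa [← h, sOp_src_inl_of_mem he]
    · exact absurd (h.symm.trans (sOp_src_inl_of_notMem he)) hxy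
  have htgt_ne {e : E} : (G.sOp e₀ C).tgt (.inl e) = G.tgt e₀ → G.tgt e₀ ∈ C := fun h => by
    by_cases he : G.tgt e ∈ C
    · rwa [← h, sOp_tgt_inl_of_mem he]
    · exact absurd ((sOp_tgt_inl_of_notMem he).symm.trans h) hxy
  obtain ⟨c, hc⟩ := hC.nonempty
  obtain ⟨e₁, he₁, hs₁, ht₁⟩ := (hG c p).exists_edge_leaving hc hpC
  obtain ⟨e₂, he₂, hs₂, ht₂⟩ := (hG p c).exists_edge_leaving (S := Cᶜ) hpC (not_not.2 hc)
  rw [Set.mem_compl_iff, not_not] at ht₂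
  have hinside : ∀ a ∈ C, ∀ b ∈ C, _ := fun a ha b hb => hC.reaches_sOp_deleteEdge hp hpC ha hb
  have enter {e : E} (he : e ∈ G.edges) (hs : G.src e ∉ C) (ht : G.tgt e ∈ C)
      (hne : Sum.inl e ≠ f) : ∃ c ∈ C, ((G.sOp e₀ C).deleteEdge f).Reaches (G.tgt e₀) c :=
    ⟨G.tgt e, ht, HasEdge.reaches ⟨.inl e, ⟨inl_mem_sOp_edges.2 ⟨he, .inr ht⟩, hne⟩,
      sOp_src_inl_of_notMem hs, sOp_tgt_inl_of_mem ht⟩⟩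
  have leave {e : E} (he : e ∈ G.edges) (hs : G.src e ∈ C) (ht : G.tgt e ∉ C)
      (hne : Sum.inl e ≠ f) : ∃ c ∈ C, ((G.sOp e₀ C).deleteEdge f).Reaches c (G.src e₀) :=
    ⟨G.src e, hs, HasEdge.reaches ⟨.inl e, ⟨inl_mem_sOp_edges.2 ⟨he, .inl hs⟩, hne⟩,
      sOp_src_inl_of_mem hs, sOp_tgt_inl_of_notMem ht⟩⟩
  rcases f with e | ⟨⟩
  · have hbridge : ((G.sOp e₀ C).deleteEdge (.inl e)).Reaches (G.src e₀) (G.tgt e₀) :=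
      HasEdge.reaches ⟨.inr (), ⟨inr_mem_sOp_edges, Sum.inr_ne_inl⟩, rfl, rfl⟩
    by_cases hs : G.src e ∈ C
    · obtain rfl : (G.sOp e₀ C).tgt (.inl e) = p :=
        hp.resolve_left fun h => hpC (h ▸ sOp_src_inl_of_mem hs ▸ hs)
      have ht : G.tgt e ∉ C := fun h => hpC (sOp_tgt_inl_of_mem h ▸ h)
      rw [sOp_tgt_inl_of_notMem ht] at hpC hin
      refine sCOn_insert_insert hC.nonempty hinside ?_ hbridge
        (enter he₂ hs₂ ht₂ fun h => hs₂ (Sum.inl_injective h ▸ hs))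
      push Not at hin
      obtain ⟨f', hf', htf', hne⟩ := hin rfl
      rcases f' with e' | ⟨⟩
      · have ht' : G.tgt e' ∉ C := fun h => hpC (htf' ▸ sOp_tgt_inl_of_mem h ▸ h)
        rw [inl_mem_sOp_edges] at hf'
        exact leave hf'.1 (hf'.2.resolve_right ht') ht' hne
      · exact absurd htf'.symm hxy
    · have ht : G.tgt e ∈ C := (inl_mem_sOp_edges.1 hf).2.resolve_left hs
      obtain rfl : (G.sOp e₀ C).src (.inl e) = p :=
        hp.resolve_right fun h => hpC (h ▸ sOp_tgt_inl_of_mem ht ▸ ht)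
      rw [sOp_src_inl_of_notMem hs] at hpC hout
      refine sCOn_insert_insert hC.nonempty hinside
        (leave he₁ hs₁ ht₁ fun h => hs (Sum.inl_injective h ▸ hs₁)) hbridge ?_
      push Not at hout
      obtain ⟨f', hf', hsf', hne⟩ := hout rfl
      rcases f' with e' | ⟨⟩
      · have hs' : G.src e' ∉ C := fun h => hpC (hsf' ▸ sOp_src_inl_of_mem h ▸ h)
        rw [inl_mem_sOp_edges] at hf'
        exact enter hf'.1 hs' (hf'.2.resolve_left hs') hne
      · exact absurd hsf' hxy
  · rcases hp with rfl | rfl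
    · refine absurd ⟨rfl, fun f' _ h => ?_⟩ hout
      rcases f' with e' | ⟨⟩
      exacts [absurd (hsrc_ne h) hpC, rfl]
    · refine absurd ⟨rfl, fun f' _ h => ?_⟩ hin
      rcases f' with e' | ⟨⟩
      exacts [absurd (htgt_ne h) hpC, rfl]

/-- If `f` is the only edge entering or the only edge leaving `p`, then the vertices of `C'` can be
ranked so that the edges of `C' \ f` never decrease the rank, while `C`, and each of the endpoints
of `e₀` outside `C`, have ranks of their own. -/
theorem exists_rank_sOp_deleteEdge (hxy : G.src e₀ ≠ G.tgt e₀)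
    (hf : f ∈ (G.sOp e₀ C).edges)
    (hp : (G.sOp e₀ C).src f = p ∨ (G.sOp e₀ C).tgt f = p) (hpC : p ∉ C)
    (honly : ((G.sOp e₀ C).tgt f = p ∧
        ∀ f' ∈ (G.sOp e₀ C).edges, (G.sOp e₀ C).tgt f' = p → f' = f) ∨
      ((G.sOp e₀ C).src f = p ∧
        ∀ f' ∈ (G.sOp e₀ C).edges, (G.sOp e₀ C).src f' = p → f' = f)) :
    ∃ r : V → ℕ, (∀ f' ∈ ((G.sOp e₀ C).deleteEdge f).edges,
        r ((G.sOp e₀ C).src f') ≤ r ((G.sOp e₀ C).tgt f')) ∧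
      ∀ a ∈ insert (G.src e₀) (insert (G.tgt e₀) C),
        ∀ b ∈ insert (G.src e₀) (insert (G.tgt e₀) C), r a = r b → a = b ∨ (a ∈ C ∧ b ∈ C) := by
  classical
  let rank (i j k : ℕ) (v : V) : ℕ := if v ∈ C then i else if v = G.src e₀ then j else k
  have rank_inj {i j k : ℕ} (hij : i ≠ j) (hik : i ≠ k) (hjk : j ≠ k) :
      ∀ a ∈ insert (G.src e₀) (insert (G.tgt e₀) C),
        ∀ b ∈ insert (G.src e₀) (insert (G.tgt e₀) C),
          rank i j k a = rank i j k b → a = b ∨ (a ∈ C ∧ b ∈ C) := by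
    intro a ha b hb
    simp only [Set.mem_insert_iff] at ha hb
    simp only [rank]
    grind
  have hsrc (e : E) : (G.sOp e₀ C).src (.inl e) = if G.src e ∈ C then G.src e else G.tgt e₀ := rfl
  have htgt (e : E) : (G.sOp e₀ C).tgt (.inl e) = if G.tgt e ∈ C then G.tgt e else G.src e₀ := rfl
  rcases f with e | ⟨⟩
  · rw [inl_mem_sOp_edges] at hf
    by_cases hs : G.src e ∈ C
    · refine ⟨rank 2 0 1, ?_, rank_inj (by decide) (by decide) (by decide)⟩
      rintro (e' | ⟨⟩) ⟨hmem, hne⟩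
      · have := inl_mem_sOp_edges.1 hmem
        simp only [rank]
        grind
      · simp only [sOp_src_inr, sOp_tgt_inr, rank]
        grind
    · refine ⟨rank 0 1 2, ?_, rank_inj (by decide) (by decide) (by decide)⟩
      rintro (e' | ⟨⟩) ⟨hmem, hne⟩
      · have := inl_mem_sOp_edges.1 hmem
        simp only [rank]
        grind
      · simp only [sOp_src_inr, sOp_tgt_inr, rank]
        grind
  · refine ⟨rank 1 2 0, ?_, rank_inj (by decide) (by decide) (by decide)⟩
    rintro (e' | ⟨⟩) ⟨hmem, hne⟩
    · simp only [hsrc, htgt, rank]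
      grind
    · exact absurd rfl hne

end sOp

end MultiDigraph

/-- Let `e₀ = (x,y)` be a strong bridge of the strongly
connected digraph `G`, let `C` be a strongly connected component of `G \ e₀`
and `C'` the corresponding digraph of `S(G,e₀)`. Let `f` be an edge of `C'`
having an endpoint `p ∉ C`. Then `f` is a strong bridge of `C'` iff it is the
only incoming edge of `p` in `C'` or the only outgoing edge of `p` in `C'`;
and in that case the strongly connected components of `C' \ f` are `{x}`
(if `x ∉ C`), `{y}` (if `y ∉ C`) and `C` (i.e. two vertices of `C'` lie in the
same strongly connected component of `C' \ f` iff they are equal or both lie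
in `C`). -/
theorem statement_15 {V E : Type} (G : MultiDigraph V E)
    (hG : G.StronglyConnected) (e₀ : E) (hbr : G.IsStrongBridge e₀)
    (C : Set V) (hC : (G.deleteEdge e₀).IsSCC C)
    (f : E ⊕ Unit) (hf : f ∈ (G.sOp e₀ C).edges) (p : V)
    (hp : (G.sOp e₀ C).src f = p ∨ (G.sOp e₀ C).tgt f = p) (hpC : p ∉ C) :
    (¬ ((G.sOp e₀ C).deleteEdge f).SCOn
          (insert (G.src e₀) (insert (G.tgt e₀) C)) ↔
        (((G.sOp e₀ C).tgt f = p ∧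
            ∀ f' ∈ (G.sOp e₀ C).edges, (G.sOp e₀ C).tgt f' = p → f' = f) ∨
          ((G.sOp e₀ C).src f = p ∧
            ∀ f' ∈ (G.sOp e₀ C).edges, (G.sOp e₀ C).src f' = p → f' = f))) ∧
    (¬ ((G.sOp e₀ C).deleteEdge f).SCOn
          (insert (G.src e₀) (insert (G.tgt e₀) C)) →
        ∀ a ∈ insert (G.src e₀) (insert (G.tgt e₀) C),
          ∀ b ∈ insert (G.src e₀) (insert (G.tgt e₀) C),
            (((G.sOp e₀ C).deleteEdge f).SConn a b ↔
              (a = b ∨ (a ∈ C ∧ b ∈ C)))) := by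
  have hxy := hbr.not_reaches hG
  have hne : G.src e₀ ≠ G.tgt e₀ := fun h => hxy (h ▸ .refl _)
  have hcomp (honly : ((G.sOp e₀ C).tgt f = p ∧
        ∀ f' ∈ (G.sOp e₀ C).edges, (G.sOp e₀ C).tgt f' = p → f' = f) ∨
      ((G.sOp e₀ C).src f = p ∧
        ∀ f' ∈ (G.sOp e₀ C).edges, (G.sOp e₀ C).src f' = p → f' = f)) :
      ∀ a ∈ insert (G.src e₀) (insert (G.tgt e₀) C),
        ∀ b ∈ insert (G.src e₀) (insert (G.tgt e₀) C),
          (((G.sOp e₀ C).deleteEdge f).SConn a b ↔ (a = b ∨ (a ∈ C ∧ b ∈ C))) := by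
    obtain ⟨r, hmono, hinj⟩ := MultiDigraph.exists_rank_sOp_deleteEdge hne hf hp hpC honly
    intro a ha b hb
    constructor
    · rintro ⟨hab, hba⟩
      exact hinj a ha b hb ((hab.le_of_monotone hmono).antisymm (hba.le_of_monotone hmono))
    · rintro (rfl | ⟨ha, hb⟩)
      · exact ⟨.refl a, .refl a⟩
      · exact ⟨hC.reaches_sOp_deleteEdge hp hpC ha hb, hC.reaches_sOp_deleteEdge hp hpC hb ha⟩
  have honly : ¬ ((G.sOp e₀ C).deleteEdge f).SCOn (insert (G.src e₀) (insert (G.tgt e₀) C)) →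
      ((G.sOp e₀ C).tgt f = p ∧
        ∀ f' ∈ (G.sOp e₀ C).edges, (G.sOp e₀ C).tgt f' = p → f' = f) ∨
      ((G.sOp e₀ C).src f = p ∧
        ∀ f' ∈ (G.sOp e₀ C).edges, (G.sOp e₀ C).src f' = p → f' = f) := by
    intro h
    by_contra hcon
    rw [not_or] at hcon
    exact h (MultiDigraph.sCOn_sOp_deleteEdge hG hbr hC hf hp hpC hcon.1 hcon.2)
  refine ⟨⟨honly, fun h hsc => ?_⟩, fun h => hcomp (honly h)⟩
  have hx : G.src e₀ ∈ insert (G.src e₀) (insert (G.tgt e₀) C) := .inl rfl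
  have hy : G.tgt e₀ ∈ insert (G.src e₀) (insert (G.tgt e₀) C) := .inr (.inl rfl)
  rcases (hcomp h _ hx _ hy).1 ⟨hsc _ hx _ hy, hsc _ hy _ hx⟩ with h | ⟨hxC, hyC⟩
  exacts [hne h, hxy (hC.reaches hxC hyC)]
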